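/- arXiv:2011.07753 — 2 statements merged into one kernel-verified Lean document; each statement's English description precedes it below -/
import Mathlib

section
/- Fix a real τ and γ > 0, and define F(x) := (1/2)·((x−τ)/√((x−τ)² + γ) + 1). Then F is differentiable with F′(x) = (γ/2)·((x−τ)² + γ)^{−3/2} for all x, F is strictly increasing, F(x) → 0 as x → −∞, and F(x) → 1 as x → +∞; moreover F′(x) equals the density of the non-standard Student t-distribution with ν = 2 degrees of freedom, location τ and scale σ with γ = 2σ², i.e. F′(x) = (1/(√(2)·2σ))·(1 + (1/2)((x−τ)/σ)²)^{−3/2}. Hence the Griffiths–Miller hyperbolic model corresponds to a random threshold with this t-distribution. -/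
open Filter Topology Real

theorem rpow_neg_three_halves {a : ℝ} (ha : 0 < a) :
    a ^ (-(3 : ℝ) / 2) = (a * √a)⁻¹ := by
  rw [show (-(3 : ℝ) / 2) = -(1 + 1 / 2) by norm_num, rpow_neg ha.le, rpow_add ha, rpow_one,
    ← sqrt_eq_rpow]

theorem hasDerivAt_div_sqrt_sq_add {γ : ℝ} (hγ : 0 < γ) (y : ℝ) :
    HasDerivAt (fun y : ℝ => y / √(y ^ 2 + γ)) (γ * (y ^ 2 + γ) ^ (-(3 : ℝ) / 2)) y := by
  have hA : 0 < y ^ 2 + γ := by positivity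
  have hs : 0 < √(y ^ 2 + γ) := sqrt_pos.2 hA
  have hsq : √(y ^ 2 + γ) ^ 2 = y ^ 2 + γ := sq_sqrt hA.le
  have h : HasDerivAt (fun y : ℝ => √(y ^ 2 + γ)) (2 * y / (2 * √(y ^ 2 + γ))) y := by
    simpa using (((hasDerivAt_id y).pow 2).add_const γ).sqrt hA.ne'
  refine ((hasDerivAt_id' y).div h hs.ne').congr_deriv ?_
  rw [rpow_neg_three_halves hA]
  field_simp
  rw [hsq]
  ring

theorem tendsto_div_sqrt_sq_add_atTop {γ : ℝ} (hγ : 0 < γ) :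
    Tendsto (fun y : ℝ => y / √(y ^ 2 + γ)) atTop (𝓝 1) := by
  have h1 : Tendsto (fun y : ℝ => γ / (y ^ 2 + γ)) atTop (𝓝 0) :=
    (tendsto_atTop_add_const_right _ γ (tendsto_pow_atTop two_ne_zero)).const_div_atTop γ
  have h2 : Tendsto (fun y : ℝ => √(1 - γ / (y ^ 2 + γ))) atTop (𝓝 1) := by
    simpa using (h1.const_sub 1).sqrt
  refine h2.congr' ?_
  filter_upwards [eventually_ge_atTop 0] with y hy
  have hA : 0 < y ^ 2 + γ := by positivity
  rw [one_sub_div hA.ne', add_sub_cancel_right, sqrt_div (sq_nonneg y), sqrt_sq hy]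

theorem tendsto_div_sqrt_sq_add_atBot {γ : ℝ} (hγ : 0 < γ) :
    Tendsto (fun y : ℝ => y / √(y ^ 2 + γ)) atBot (𝓝 (-1)) := by
  refine ((tendsto_div_sqrt_sq_add_atTop hγ).comp tendsto_neg_atBot_atTop).neg.congr fun y => ?_
  simp [neg_div]

/-- The Griffiths–Miller hyperbolic model corresponds to a random threshold
with the non-standard Student t-distribution with 2 degrees of freedom:
`F(x) = ((x−τ)/√((x−τ)²+γ) + 1)/2` is a differentiable, strictly increasing
CDF with density `F′(x) = (γ/2)·((x−τ)²+γ)^{−3/2}`, which equals the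
non-standard t₂ density with location `τ` and scale `σ` when `γ = 2σ²`. -/
theorem griffiths_miller_t_distribution (τ γ : ℝ) (hγ : 0 < γ)
    (F : ℝ → ℝ)
    (hF : ∀ x, F x = ((x - τ) / Real.sqrt ((x - τ) ^ 2 + γ) + 1) / 2) :
    (∀ x, HasDerivAt F (γ / 2 * ((x - τ) ^ 2 + γ) ^ (-(3 : ℝ) / 2)) x) ∧
    StrictMono F ∧
    Tendsto F atBot (𝓝 0) ∧
    Tendsto F atTop (𝓝 1) ∧
    (∀ σ : ℝ, 0 < σ → γ = 2 * σ ^ 2 → ∀ x : ℝ,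
      γ / 2 * ((x - τ) ^ 2 + γ) ^ (-(3 : ℝ) / 2) =
        (1 / (Real.sqrt 2 * (2 * σ))) *
          (1 + (1 / 2) * ((x - τ) / σ) ^ 2) ^ (-(3 : ℝ) / 2)) := by
  obtain rfl : F = fun x => ((x - τ) / √((x - τ) ^ 2 + γ) + 1) / 2 := funext hF
  have hderiv : ∀ x, HasDerivAt (fun x => ((x - τ) / √((x - τ) ^ 2 + γ) + 1) / 2)
      (γ / 2 * ((x - τ) ^ 2 + γ) ^ (-(3 : ℝ) / 2)) x := fun x =>
    ((((hasDerivAt_div_sqrt_sq_add hγ (x - τ)).comp_sub_const x τ).add_const 1).div_const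
      2).congr_deriv (by ring)
  refine ⟨hderiv, ?_, ?_, ?_, ?_⟩
  · refine strictMono_of_deriv_pos fun x => ?_
    rw [(hderiv x).deriv]
    positivity
  · simpa [Function.comp_def] using (((tendsto_div_sqrt_sq_add_atBot hγ).comp
      (tendsto_atBot_add_const_right _ (-τ) tendsto_id)).add_const 1).div_const 2
      |>.congr fun x => by simp [← sub_eq_add_neg]
  · simpa [Function.comp_def] using (((tendsto_div_sqrt_sq_add_atTop hγ).comp
      (tendsto_atTop_add_const_right _ (-τ) tendsto_id)).add_const 1).div_const 2
      |>.congr fun x => by simp [← sub_eq_add_neg]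
  · rintro σ hσ rfl x
    have hB : 0 < 1 + 1 / 2 * ((x - τ) / σ) ^ 2 := by positivity
    have hscale : (x - τ) ^ 2 + 2 * σ ^ 2 =
        2 * σ ^ 2 * (1 + 1 / 2 * ((x - τ) / σ) ^ 2) := by
      field_simp
      ring
    rw [hscale, mul_rpow (by positivity) hB.le, ← mul_assoc, rpow_neg_three_halves hγ,
      sqrt_mul zero_le_two, sqrt_sq hσ.le]
    congr 1
    field_simp
end

section
/- Fix a real τ and ζ > 0, and let μ be the probability measure on ℝ with Epanechnikov density f(t) = 3(ζ² − (t−τ)²)/(4ζ³) for t ∈ [τ−ζ, τ+ζ] and f(t) = 0 otherwise. Then for every x with τ−ζ ≤ x ≤ τ+ζ, ∫ max(x − t, 0) dμ(t) = −(x−τ)⁴/(16ζ³) + 3(x−τ)²/(8ζ) + (x−τ)/2 + 3ζ/16; moreover the integral equals 0 for x < τ−ζ and equals x−τ for x > τ+ζ. Hence the fourth-degree polynomial (Epanechnikov) bent-cable is the expected bending-cable model with an Epanechnikov-distributed threshold. -/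
open MeasureTheory

/-- The expectation of `g` under the Epanechnikov distribution on `[τ - ζ, τ + ζ]`, as an interval
integral against the density. -/
lemma integral_epanechnikov_eq_intervalIntegral {τ ζ : ℝ} (hζ : 0 < ζ) {f : ℝ → ℝ}
    (hf : ∀ t, f t = if t ∈ Set.Icc (τ - ζ) (τ + ζ)
      then 3 * (ζ ^ 2 - (t - τ) ^ 2) / (4 * ζ ^ 3) else 0) (g : ℝ → ℝ) :
    ∫ t, g t ∂(volume.withDensity fun t => ENNReal.ofReal (f t)) =
      ∫ t in (τ - ζ)..(τ + ζ), 3 * (ζ ^ 2 - (t - τ) ^ 2) / (4 * ζ ^ 3) * g t := by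
  have hf_nonneg : ∀ t, 0 ≤ f t := by
    intro t
    rw [hf]
    split_ifs with ht
    · have : (t - τ) ^ 2 ≤ ζ ^ 2 := sq_le_sq' (by linarith [ht.1]) (by linarith [ht.2])
      have : 0 ≤ ζ ^ 2 - (t - τ) ^ 2 := by linarith
      positivity
    · exact le_rfl
  have hf_meas : Measurable f := by
    rw [funext hf]
    exact Measurable.ite measurableSet_Icc (by fun_prop) measurable_const
  rw [integral_withDensity_eq_integral_toReal_smul hf_meas.ennreal_ofReal (by simp),
    intervalIntegral.integral_of_le (by linarith), ← integral_Icc_eq_integral_Ioc,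
    ← integral_indicator measurableSet_Icc]
  congr 1
  ext t
  rw [ENNReal.toReal_ofReal (hf_nonneg t), hf, Set.indicator_apply, smul_eq_mul]
  split_ifs <;> simp

/-- The partial first moment of the Epanechnikov density about `x`. -/
lemma intervalIntegral_epanechnikov_mul_sub (τ ζ x a b : ℝ) :
    ∫ t in a..b, 3 * (ζ ^ 2 - (t - τ) ^ 2) / (4 * ζ ^ 3) * (x - t) =
      3 / (4 * ζ ^ 3) *
        ((ζ ^ 2 * (x - τ) * (b - τ) - ζ ^ 2 * (b - τ) ^ 2 / 2 - (x - τ) * (b - τ) ^ 3 / 3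
            + (b - τ) ^ 4 / 4)
          - (ζ ^ 2 * (x - τ) * (a - τ) - ζ ^ 2 * (a - τ) ^ 2 / 2 - (x - τ) * (a - τ) ^ 3 / 3
            + (a - τ) ^ 4 / 4)) := by
  rw [mul_sub]
  refine intervalIntegral.integral_eq_sub_of_hasDerivAt (f := fun t => 3 / (4 * ζ ^ 3) *
    (ζ ^ 2 * (x - τ) * (t - τ) - ζ ^ 2 * (t - τ) ^ 2 / 2 - (x - τ) * (t - τ) ^ 3 / 3
      + (t - τ) ^ 4 / 4)) (fun t _ => ?_)
    (Continuous.intervalIntegrable (by fun_prop) _ _)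
  have h : HasDerivAt (fun t => t - τ) 1 t := (hasDerivAt_id t).sub_const τ
  refine (((((h.const_mul (ζ ^ 2 * (x - τ))).sub (((h.pow 2).const_mul (ζ ^ 2)).div_const 2)).sub
    (((h.pow 3).const_mul (x - τ)).div_const 3)).add
      ((h.pow 4).div_const 4)).const_mul (3 / (4 * ζ ^ 3))).congr_deriv ?_
  push_cast
  ring

/-- The fourth-degree polynomial (Epanechnikov) bent-cable is the expected
bending-cable model with an Epanechnikov-distributed random threshold. -/
theorem epanechnikov_bent_cable (τ ζ : ℝ) (hζ : 0 < ζ)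
    (f : ℝ → ℝ)
    (hf : ∀ t, f t = if t ∈ Set.Icc (τ - ζ) (τ + ζ)
      then 3 * (ζ ^ 2 - (t - τ) ^ 2) / (4 * ζ ^ 3) else 0)
    (μ : Measure ℝ)
    (hμ : μ = MeasureTheory.volume.withDensity (fun t => ENNReal.ofReal (f t))) (x : ℝ) :
    (τ - ζ ≤ x → x ≤ τ + ζ → ∫ t, max (x - t) 0 ∂μ =
      -(x - τ) ^ 4 / (16 * ζ ^ 3) + 3 * (x - τ) ^ 2 / (8 * ζ)
        + (x - τ) / 2 + 3 * ζ / 16) ∧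
    (x < τ - ζ → ∫ t, max (x - t) 0 ∂μ = 0) ∧
    (τ + ζ < x → ∫ t, max (x - t) 0 ∂μ = x - τ) := by
  have key (g : ℝ → ℝ) := integral_epanechnikov_eq_intervalIntegral hζ hf g
  have hle : τ - ζ ≤ τ + ζ := by linarith
  subst hμ
  rw [key]
  refine ⟨fun hax hxb => ?_, fun hx => ?_, fun hx => ?_⟩
  · have left : ∫ t in (τ - ζ)..x, 3 * (ζ ^ 2 - (t - τ) ^ 2) / (4 * ζ ^ 3) * max (x - t) 0 =
        ∫ t in (τ - ζ)..x, 3 * (ζ ^ 2 - (t - τ) ^ 2) / (4 * ζ ^ 3) * (x - t) := by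
      refine intervalIntegral.integral_congr fun t ht => ?_
      rw [Set.uIcc_of_le hax] at ht
      simp only [max_eq_left (sub_nonneg.2 ht.2)]
    have right :
        ∫ t in x..(τ + ζ), 3 * (ζ ^ 2 - (t - τ) ^ 2) / (4 * ζ ^ 3) * max (x - t) 0 = 0 := by
      refine intervalIntegral.integral_zero_ae (.of_forall fun t ht => ?_)
      rw [Set.uIoc_of_le hxb] at ht
      rw [max_eq_right (by linarith [ht.1]), mul_zero]
    rw [← intervalIntegral.integral_add_adjacent_intervals (b := x)
      (Continuous.intervalIntegrable (by fun_prop) _ _)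
      (Continuous.intervalIntegrable (by fun_prop) _ _), left, right,
      intervalIntegral_epanechnikov_mul_sub]
    field_simp
    ring
  · refine intervalIntegral.integral_zero_ae (.of_forall fun t ht => ?_)
    rw [Set.uIoc_of_le hle] at ht
    rw [max_eq_right (by linarith [ht.1]), mul_zero]
  · have : ∫ t in (τ - ζ)..(τ + ζ), 3 * (ζ ^ 2 - (t - τ) ^ 2) / (4 * ζ ^ 3) * max (x - t) 0 =
        ∫ t in (τ - ζ)..(τ + ζ), 3 * (ζ ^ 2 - (t - τ) ^ 2) / (4 * ζ ^ 3) * (x - t) := by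
      refine intervalIntegral.integral_congr fun t ht => ?_
      rw [Set.uIcc_of_le hle] at ht
      simp only [max_eq_left (show 0 ≤ x - t by linarith [ht.2])]
    rw [this, intervalIntegral_epanechnikov_mul_sub]
    field_simp
    ring
end
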